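/- Let r > 0 and Λ > 0, and let η be the Haar probability measure on SU(2). Then the pushforward of η under the map k ↦ (1/r)·log(e^{rΛ}·|k_{11}|² + e^{−rΛ}·|k_{12}|²) (where k_{11}, k_{12} are the entries of the first row of k) is the probability measure on ℝ with density x ↦ r·e^{r·x}/(e^{rΛ} − e^{−rΛ}) with respect to Lebesgue measure restricted to [−Λ, Λ]. -/

import Mathlib

open MeasureTheory Real

/-- We endow `SU(2)` with its Borel σ-algebra. -/
noncomputable instance : MeasurableSpace (Matrix.specialUnitaryGroup (Fin 2) ℂ) :=
  borel _

abbrev GSU : Type := Matrix.specialUnitaryGroup (Fin 2) ℂ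

instance : BorelSpace (Matrix.specialUnitaryGroup (Fin 2) ℂ) := ⟨rfl⟩

/-- Low coefficients of a power of a quadratic polynomial. -/
lemma coeffs_pow (u w v : ℝ) (n : ℕ) :
    ((Polynomial.C u + Polynomial.C w * Polynomial.X + Polynomial.C v * Polynomial.X ^ 2) ^ n).coeff 0
        = u ^ n ∧
    ((Polynomial.C u + Polynomial.C w * Polynomial.X + Polynomial.C v * Polynomial.X ^ 2) ^ n).coeff 1
        = n * u ^ (n - 1) * w ∧
    ((Polynomial.C u + Polynomial.C w * Polynomial.X
        + Polynomial.C v * Polynomial.X ^ 2) ^ n).coeff 2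
        = n * u ^ (n - 1) * v + n * (n - 1) / 2 * u ^ (n - 2) * w ^ 2 := by
  set P := (Polynomial.C u + Polynomial.C w * Polynomial.X + Polynomial.C v * Polynomial.X ^ 2) with hP
  have p0 : P.coeff 0 = u := by simp [hP]
  have p1 : P.coeff 1 = w := by simp [hP, Polynomial.coeff_C, Polynomial.coeff_X_pow]
  have p2 : P.coeff 2 = v := by simp [hP, Polynomial.coeff_X, Polynomial.coeff_X_pow]
  induction n with
  | zero => simp [Polynomial.coeff_one]
  | succ n ih =>
    obtain ⟨h0, h1, h2⟩ := ih
    have e1 : (P ^ (n + 1)).coeff 1 = (P ^ n).coeff 0 * w + (P ^ n).coeff 1 * u := by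
      rw [pow_succ, Polynomial.coeff_mul, Finset.Nat.antidiagonal_succ]
      simp [p0, p1]
    have e2 : (P ^ (n + 1)).coeff 2
        = (P ^ n).coeff 0 * v + (P ^ n).coeff 1 * w + (P ^ n).coeff 2 * u := by
      rw [pow_succ, Polynomial.coeff_mul]
      simp [Finset.Nat.antidiagonal_succ, p0, p1, p2]; ring
    refine ⟨?_, ?_, ?_⟩
    · rw [pow_succ, Polynomial.mul_coeff_zero, h0, p0, pow_succ]
    · rw [e1, h0, h1]
      rcases n with _ | n
      · simp
      · simp only [Nat.add_sub_cancel]; push_cast; ring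
    · rw [e2, h0, h1, h2]
      rcases n with _ | _ | n
      · simp
      · simp; ring
      · simp only [Nat.add_sub_cancel, show n + 1 + 1 + 1 - 2 = n + 1 by omega,
          show n + 1 + 1 - 2 = n by omega]
        push_cast; ring

lemma su_col (k : GSU) : Complex.normSq (k.1 0 0) + Complex.normSq (k.1 1 0) = 1 := by
  have h := (Matrix.mem_specialUnitaryGroup_iff.1 k.2).1
  have h1 := (Matrix.mem_unitaryGroup_iff'.1 h)
  have h2 := congrFun (congrFun h1 0) 0
  simp only [Matrix.mul_apply, Fin.sum_univ_two, Matrix.star_apply, Matrix.one_apply_eq] at h2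
  have h3 := congrArg Complex.re h2
  simp [Complex.normSq_apply] at h3 ⊢
  linarith

lemma su_row (k : GSU) : Complex.normSq (k.1 0 0) + Complex.normSq (k.1 0 1) = 1 := by
  have h := (Matrix.mem_specialUnitaryGroup_iff.1 k.2).1
  have h1 := (Matrix.mem_unitaryGroup_iff.1 h)
  have h2 := congrFun (congrFun h1 0) 0
  simp only [Matrix.mul_apply, Fin.sum_univ_two, Matrix.star_apply, Matrix.one_apply_eq] at h2
  have h3 := congrArg Complex.re h2
  simp [Complex.normSq_apply] at h3 ⊢
  linarith

/-- The rotation with first row proportional to `(1, z)`. -/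
lemma exists_rot (z : ℂ) : ∃ g : GSU, ∀ k : GSU,
    (1 + Complex.normSq z) * Complex.normSq ((g * k).1 0 0)
      = Complex.normSq (k.1 0 0 + z * k.1 1 0) := by
  have hpos : 0 < 1 + Complex.normSq z := by have := Complex.normSq_nonneg z; linarith
  set t : ℝ := (√(1 + Complex.normSq z))⁻¹ with ht
  have ht2 : t * t * (1 + Complex.normSq z) = 1 := by
    rw [ht, ← mul_inv, Real.mul_self_sqrt hpos.le, inv_mul_cancel₀ hpos.ne']
  have hc : (t : ℂ) * t * (1 + z * (starRingEnd ℂ) z) = 1 := by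
    rw [Complex.mul_conj]; exact_mod_cast ht2
  let M : Matrix (Fin 2) (Fin 2) ℂ := !![(t : ℂ), t * z; -(t * (starRingEnd ℂ) z), t]
  have hM : M ∈ Matrix.specialUnitaryGroup (Fin 2) ℂ := by
    rw [Matrix.mem_specialUnitaryGroup_iff, Matrix.mem_unitaryGroup_iff]
    constructor
    · ext i j
      fin_cases i <;> fin_cases j <;>
        simp [M, Matrix.mul_apply, Fin.sum_univ_two, Matrix.star_apply] <;>
        first | linear_combination hc | ring
    · rw [Matrix.det_fin_two]; simp [M]; linear_combination hc
  refine ⟨⟨M, hM⟩, fun k => ?_⟩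
  have : ((⟨M, hM⟩ : GSU) * k).1 0 0 = t * (k.1 0 0 + z * k.1 1 0) := by
    change (M * k.1) 0 0 = _
    simp [M, Matrix.mul_apply, Fin.sum_univ_two]; ring
  rw [this, Complex.normSq_mul, Complex.normSq_ofReal]
  linear_combination Complex.normSq (k.1 0 0 + z * k.1 1 0) * ht2

lemma cont_entry (i j : Fin 2) : Continuous (fun k : GSU => k.1 i j) :=
  (continuous_apply_apply i j).comp continuous_subtype_val

lemma cont_mul (g : GSU) : Continuous (fun k : GSU => g * k) := by
  refine Continuous.subtype_mk (f := fun k : GSU => g.1 * k.1) ?_ _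
  exact continuous_const.matrix_mul continuous_subtype_val

lemma su_compact :
    IsCompact ((Matrix.specialUnitaryGroup (Fin 2) ℂ : Set (Matrix (Fin 2) (Fin 2) ℂ))) := by
  have hK : IsCompact (Set.univ.pi fun _ : Fin 2 => Set.univ.pi fun _ : Fin 2 =>
      Metric.closedBall (0 : ℂ) 1) :=
    isCompact_univ_pi fun _ => isCompact_univ_pi fun _ => isCompact_closedBall 0 1
  refine IsCompact.of_isClosed_subset (X := Matrix (Fin 2) (Fin 2) ℂ) hK ?_ ?_
  · have : (Matrix.specialUnitaryGroup (Fin 2) ℂ : Set (Matrix (Fin 2) (Fin 2) ℂ))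
        = {A | A * star A = 1} ∩ {A | A.det = 1} := by
      ext A
      simp [Matrix.mem_specialUnitaryGroup_iff, Matrix.mem_unitaryGroup_iff]
    rw [this]
    refine IsClosed.inter (isClosed_eq ?_ continuous_const) (isClosed_eq ?_ continuous_const)
    · exact continuous_id.matrix_mul continuous_id.matrix_conjTranspose
    · exact continuous_id.matrix_det
  · intro A hA
    have h := (Matrix.mem_specialUnitaryGroup_iff.1 hA).1
    intro i _ j _
    refine mem_closedBall_zero_iff.2 ?_
    exact entry_norm_bound_of_unitary h i j

instance : CompactSpace GSU := isCompact_iff_compactSpace.1 su_compact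

/-- The cross term. -/
noncomputable def cross (z : ℂ) (k : GSU) : ℝ :=
  2 * (k.1 0 0 * (starRingEnd ℂ) (z * k.1 1 0)).re

lemma cont_cross (z : ℂ) : Continuous (cross z) := by
  unfold cross
  exact continuous_const.mul (Complex.continuous_re.comp ((cont_entry 0 0).mul
    (Complex.continuous_conj.comp (continuous_const.mul (cont_entry 1 0)))))

noncomputable def uu (k : GSU) : ℝ := Complex.normSq (k.1 0 0)

lemma cont_uu : Continuous uu := Complex.continuous_normSq.comp (cont_entry 0 0)

noncomputable def qp (z : ℂ) (n : ℕ) (k : GSU) : Polynomial ℝ :=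
  (Polynomial.C (uu k) + Polynomial.C (cross z k) * Polynomial.X
    + Polynomial.C (1 - uu k) * Polynomial.X ^ 2) ^ n

lemma cont_qp (z : ℂ) (n j : ℕ) : Continuous (fun k => (qp z n k).coeff j) := by
  induction n generalizing j with
  | zero => simp only [qp, pow_zero]; exact continuous_const
  | succ n ih =>
    have : (fun k => (qp z (n+1) k).coeff j) = fun k =>
      ∑ x ∈ Finset.HasAntidiagonal.antidiagonal j, (qp z n k).coeff x.1 *
        (Polynomial.C (uu k) + Polynomial.C (cross z k) * Polynomial.X
          + Polynomial.C (1 - uu k) * Polynomial.X ^ 2).coeff x.2 := by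
      funext k
      rw [← Polynomial.coeff_mul]; simp only [qp, pow_succ]
    rw [this]
    refine continuous_finsetSum _ fun x _ => (ih x.1).mul ?_
    have := cont_uu
    have := cont_cross z
    simp only [Polynomial.coeff_add, Polynomial.coeff_C_mul, Polynomial.coeff_C]
    split_ifs <;> fun_prop

lemma int_cont (η : Measure GSU) [IsProbabilityMeasure η] {f : GSU → ℝ} (hf : Continuous f) :
    Integrable f η :=
  hf.integrable_of_hasCompactSupport (HasCompactSupport.of_compactSpace f)

lemma qp_natDegree (z : ℂ) (n : ℕ) (k : GSU) : (qp z n k).natDegree < 2 * n + 1 := by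
  unfold qp
  have : (Polynomial.C (uu k) + Polynomial.C (cross z k) * Polynomial.X
    + Polynomial.C (1 - uu k) * Polynomial.X ^ 2).natDegree ≤ 2 := by compute_degree
  have h2 := Polynomial.natDegree_pow_le_of_le n this
  omega

lemma coeff_two_identity (η : Measure GSU) [IsProbabilityMeasure η]
    (hinv : ∀ g : GSU, η.map (fun k => g * k) = η) (z : ℂ) (hz : Complex.normSq z = 1) (n : ℕ) :
    ∫ k, (qp z n k).coeff 2 ∂η = n * ∫ k, uu k ^ n ∂η := by
  have key : (∑ j ∈ Finset.range (2 * n + 1),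
      Polynomial.C (∫ k, (qp z n k).coeff j ∂η) * Polynomial.X ^ j)
      = Polynomial.C (∫ k, uu k ^ n ∂η) *
        (Polynomial.C 1 + Polynomial.C 0 * Polynomial.X + Polynomial.C 1 * Polynomial.X ^ 2) ^ n := by
    apply Polynomial.funext
    intro s
    simp only [Polynomial.eval_finsetSum, Polynomial.eval_mul, Polynomial.eval_C, Polynomial.eval_pow,
      Polynomial.eval_X, Polynomial.eval_add]
    have e1 : ∑ j ∈ Finset.range (2 * n + 1), (∫ k, (qp z n k).coeff j ∂η) * s ^ j
        = ∫ k, (qp z n k).eval s ∂η := by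
      rw [show (fun k => (qp z n k).eval s) = fun k => ∑ j ∈ Finset.range (2 * n + 1),
        (qp z n k).coeff j * s ^ j from funext fun k =>
          Polynomial.eval_eq_sum_range' (qp_natDegree z n k) s]
      rw [integral_finsetSum _ fun j _ => (int_cont η (cont_qp z n j)).mul_const _]
      exact Finset.sum_congr rfl fun j _ => (integral_mul_const _ _).symm
    rw [e1]
    obtain ⟨g, hg⟩ := exists_rot (s * z)
    have e2 : ∫ k, uu k ^ n ∂η = ∫ k, uu (g * k) ^ n ∂η := by
      conv_lhs => rw [← hinv g]
      rw [integral_map (f := fun k => uu k ^ n) (cont_mul g).aemeasurable (cont_uu.pow n).aestronglyMeasurable]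
    rw [e2, ← integral_mul_const]
    congr 1
    funext k
    have h1 := hg k
    have h2 := su_col k
    rw [Complex.normSq_mul, hz, Complex.normSq_ofReal] at h1
    simp only [qp, Polynomial.eval_mul, Polynomial.eval_C, Polynomial.eval_pow,
      Polynomial.eval_X, Polynomial.eval_add]
    rw [← mul_pow]
    congr 1
    have h3 : Complex.normSq (k.1 0 0 + s * z * k.1 1 0) =
        uu k + cross z k * s + (1 - uu k) * s ^ 2 := by
      rw [Complex.normSq_add, Complex.normSq_mul, Complex.normSq_mul, hz, Complex.normSq_ofReal]
      have : Complex.normSq (k.1 1 0) = 1 - uu k := by unfold uu; linarith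
      rw [this]
      have h5 : (k.1 0 0 * (starRingEnd ℂ) (s * z * k.1 1 0)).re
          = s * (k.1 0 0 * (starRingEnd ℂ) (z * k.1 1 0)).re := by
        rw [← Complex.re_ofReal_mul]; congr 1
        simp only [map_mul, Complex.conj_ofReal]; ring
      rw [h5]; unfold uu cross; ring
    rw [← h3, ← h1]; unfold uu; ring
  have h := congrArg (fun p => p.coeff 2) key
  simp only [Polynomial.coeff_C_mul, Polynomial.finsetSum_coeff, Polynomial.coeff_X_pow] at h
  have hc := (coeffs_pow 1 0 1 n).2.2
  rw [hc] at h
  rcases Nat.eq_zero_or_pos n with rfl | hn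
  · simp [qp, Polynomial.coeff_one]
  rw [Finset.sum_eq_single 2] at h
  · simp at h; rw [h]; ring
  · intro b _ hb; simp [Ne.symm hb]
  · intro hb; simp at hb; omega

lemma cross_sq (k : GSU) : cross 1 k ^ 2 + cross Complex.I k ^ 2 = 4 * uu k * (1 - uu k) := by
  have h2 := su_col k
  have : Complex.normSq (k.1 1 0) = 1 - uu k := by unfold uu; linarith
  rw [← this]
  simp [cross, uu, Complex.normSq_apply]
  ring

lemma moment_succ (η : Measure GSU) [IsProbabilityMeasure η]
    (hinv : ∀ g : GSU, η.map (fun k => g * k) = η) (n : ℕ) :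
    ((n : ℝ) + 2) * ∫ k, uu k ^ (n + 1) ∂η = (n + 1) * ∫ k, uu k ^ n ∂η := by
  have h1 := coeff_two_identity η hinv 1 (by simp) (n + 1)
  have h2 := coeff_two_identity η hinv Complex.I (by simp) (n + 1)
  have hs : ∫ k, (qp 1 (n + 1) k).coeff 2 ∂η + ∫ k, (qp Complex.I (n + 1) k).coeff 2 ∂η
      = ∫ k, (2 * ((n : ℝ) + 1) ^ 2) * (uu k ^ n - uu k ^ (n + 1)) ∂η := by
    rw [← integral_add (int_cont η (cont_qp _ _ _)) (int_cont η (cont_qp _ _ _))]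
    congr 1
    funext k
    unfold qp
    rw [(coeffs_pow _ _ _ _).2.2, (coeffs_pow _ _ _ _).2.2]
    have hc := cross_sq k
    rcases n with _ | n
    · simp; ring
    · simp only [Nat.add_sub_cancel, show n + 1 + 1 - 2 = n by omega]
      push_cast
      linear_combination ((n : ℝ) + 2) * (n + 1) / 2 * uu k ^ n * hc
  rw [h1, h2, integral_const_mul, 
    integral_sub (f := fun k => uu k ^ n) (g := fun k => uu k ^ (n + 1))
    (int_cont η (cont_uu.pow _)) (int_cont η (cont_uu.pow _))] at hs
  push_cast at hs
  have hn : (2 * ((n : ℝ) + 1)) ≠ 0 := by positivity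
  apply mul_left_cancel₀ hn
  linear_combination hs

lemma moment (η : Measure GSU) [IsProbabilityMeasure η]
    (hinv : ∀ g : GSU, η.map (fun k => g * k) = η) (n : ℕ) :
    ∫ k, uu k ^ n ∂η = 1 / ((n : ℝ) + 1) := by
  induction n with
  | zero => simp
  | succ n ih =>
    have h := moment_succ η hinv n
    rw [ih] at h
    push_cast
    field_simp at h ⊢
    linarith

lemma uu_mem (k : GSU) : uu k ∈ Set.Icc (0 : ℝ) 1 := by
  have h := su_col k
  have h1 := Complex.normSq_nonneg (k.1 0 0)
  have h2 := Complex.normSq_nonneg (k.1 1 0)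
  constructor <;> unfold uu <;> linarith

lemma poly_moment (η : Measure GSU) [IsProbabilityMeasure η]
    (hinv : ∀ g : GSU, η.map (fun k => g * k) = η) (p : Polynomial ℝ) :
    ∫ k, p.eval (uu k) ∂η = ∫ x in Set.Icc (0 : ℝ) 1, p.eval x := by
  induction p using Polynomial.induction_on' with
  | add p q hp hq =>
    simp only [Polynomial.eval_add]
    rw [integral_add (f := fun k => p.eval (uu k)) (g := fun k => q.eval (uu k))
      (int_cont η (p.continuous.comp cont_uu)) (int_cont η (q.continuous.comp cont_uu)),
      integral_add p.continuous.continuousOn.integrableOn_Icc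
        q.continuous.continuousOn.integrableOn_Icc, hp, hq]
  | monomial n a =>
    simp only [Polynomial.eval_monomial]
    rw [integral_const_mul, integral_const_mul, moment η hinv, integral_Icc_eq_integral_Ioc,
      ← intervalIntegral.integral_of_le zero_le_one, integral_pow]
    simp

lemma law_uu (η : Measure GSU) [IsProbabilityMeasure η]
    (hinv : ∀ g : GSU, η.map (fun k => g * k) = η) :
    η.map uu = (volume : Measure ℝ).restrict (Set.Icc 0 1) := by
  have : IsProbabilityMeasure (η.map uu) :=
    Measure.isProbabilityMeasure_map cont_uu.aemeasurable
  refine ext_of_forall_integral_eq_of_IsFiniteMeasure fun f => ?_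
  rw [integral_map cont_uu.aemeasurable f.continuous.aestronglyMeasurable]
  refine eq_of_abs_sub_le_all fun ε hε => ?_
  obtain ⟨p, hp⟩ := exists_polynomial_near_of_continuousOn 0 1 f f.continuous.continuousOn (ε / 2)
    (by positivity)
  have h1 : |∫ k, f (uu k) ∂η - ∫ k, p.eval (uu k) ∂η| ≤ ε / 2 := by
    rw [← integral_sub (f := fun k => f (uu k)) (g := fun k => p.eval (uu k))
      (int_cont η (f.continuous.comp cont_uu)) (int_cont η (p.continuous.comp cont_uu))]
    have := norm_integral_le_of_norm_le_const (μ := η) (C := ε / 2)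
      (f := fun k => f (uu k) - p.eval (uu k))
      (Filter.Eventually.of_forall fun k => by
        rw [Real.norm_eq_abs, abs_sub_comm]; exact (hp _ (uu_mem k)).le)
    simpa using this
  have h2 : |(∫ x in Set.Icc (0 : ℝ) 1, p.eval x) - ∫ x in Set.Icc (0 : ℝ) 1, f x| ≤ ε / 2 := by
    rw [← integral_sub p.continuous.continuousOn.integrableOn_Icc
      f.continuous.continuousOn.integrableOn_Icc]
    have := norm_setIntegral_le_of_norm_le_const (μ := (volume : Measure ℝ)) (C := ε / 2)
      (s := Set.Icc (0 : ℝ) 1) (f := fun x => p.eval x - f x) (by simp)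
      (fun x hx => by rw [Real.norm_eq_abs]; exact (hp x hx).le)
    simpa using this
  rw [poly_moment η hinv] at h1
  have := abs_sub_le (∫ k, f (uu k) ∂η) (∫ x in Set.Icc (0 : ℝ) 1, p.eval x)
    (∫ x in Set.Icc (0 : ℝ) 1, f x)
  linarith

lemma map_uniform (r Λ : ℝ) (hr : 0 < r) (hΛ : 0 < Λ) (T : ℝ → ℝ) (hT : Measurable T)
    (hTd : ∀ x ∈ Set.Icc (0 : ℝ) 1,
      T x = (1 / r) * Real.log (Real.exp (r * Λ) * x + Real.exp (-(r * Λ)) * (1 - x))) :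
    ((volume : Measure ℝ).restrict (Set.Icc 0 1)).map T =
      ((volume : Measure ℝ).restrict (Set.Icc (-Λ) Λ)).withDensity
        (fun x => ENNReal.ofReal
          (r * Real.exp (r * x) / (Real.exp (r * Λ) - Real.exp (-(r * Λ))))) := by
  have hrL : 0 < r * Λ := by positivity
  set A := Real.exp (r * Λ) with hA
  set B := Real.exp (-(r * Λ)) with hB
  have hAB : 0 < A - B := by
    have : B < A := Real.exp_lt_exp.2 (by linarith)
    linarith
  have hBpos : 0 < B := Real.exp_pos _
  let S : ℝ → ℝ := fun x => (Real.exp (r * x) - B) / (A - B)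
  have hSmem : ∀ x ∈ Set.Icc (-Λ) Λ, S x ∈ Set.Icc (0 : ℝ) 1 := by
    intro x hx
    have h1 : B ≤ Real.exp (r * x) := Real.exp_le_exp.2 (by nlinarith [hx.1])
    have h2 : Real.exp (r * x) ≤ A := Real.exp_le_exp.2 (by nlinarith [hx.2])
    exact ⟨div_nonneg (by linarith) hAB.le, (div_le_one hAB).2 (by linarith)⟩
  have hTS : ∀ x ∈ Set.Icc (-Λ) Λ, T (S x) = x := by
    intro x hx
    rw [hTd _ (hSmem x hx)]
    have : A * S x + B * (1 - S x) = Real.exp (r * x) := by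
      simp only [S]; field_simp; ring
    rw [this, Real.log_exp]; field_simp
  have hTmem : ∀ y ∈ Set.Icc (0 : ℝ) 1, T y ∈ Set.Icc (-Λ) Λ ∧ S (T y) = y := by
    intro y hy
    have hpos : 0 < A * y + B * (1 - y) := by nlinarith [hy.1, hy.2]
    have he : r * T y = Real.log (A * y + B * (1 - y)) := by
      rw [hTd y hy]; field_simp
    have he2 : Real.exp (r * T y) = A * y + B * (1 - y) := by rw [he, Real.exp_log hpos]
    refine ⟨⟨?_, ?_⟩, ?_⟩
    · have : B ≤ Real.exp (r * T y) := by rw [he2]; nlinarith [hy.1]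
      have := Real.exp_le_exp.1 this
      nlinarith
    · have : Real.exp (r * T y) ≤ A := by rw [he2]; nlinarith [hy.2]
      have := Real.exp_le_exp.1 this
      nlinarith
    · simp only [S, he2]; field_simp; ring
  ext E hE
  rw [Measure.map_apply hT hE, withDensity_apply _ hE, Measure.restrict_apply (hT hE),
    Measure.restrict_restrict hE]
  have himg : S '' (E ∩ Set.Icc (-Λ) Λ) = T ⁻¹' E ∩ Set.Icc 0 1 := by
    ext y
    constructor
    · rintro ⟨x, ⟨hxE, hx⟩, rfl⟩
      exact ⟨by rw [Set.mem_preimage, hTS x hx]; exact hxE, hSmem x hx⟩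
    · rintro ⟨hyE, hy⟩
      exact ⟨T y, ⟨hyE, (hTmem y hy).1⟩, (hTmem y hy).2⟩
  have hinj : Set.InjOn S (E ∩ Set.Icc (-Λ) Λ) := by
    intro x hx y hy hxy
    rw [← hTS x hx.2, ← hTS y hy.2, hxy]
  have hder : ∀ x ∈ E ∩ Set.Icc (-Λ) Λ,
      HasDerivWithinAt S (r * Real.exp (r * x) / (A - B)) (E ∩ Set.Icc (-Λ) Λ) x := by
    intro x _
    have h1 : HasDerivAt (fun x => r * x) r x := by simpa using (hasDerivAt_id x).const_mul r
    have h2 := ((h1.exp.sub_const B).div_const (A - B)).hasDerivWithinAt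
      (s := E ∩ Set.Icc (-Λ) Λ)
    rw [mul_comm r]; exact h2
  have h := lintegral_image_eq_lintegral_abs_deriv_mul (hE.inter measurableSet_Icc) hder hinj
    (fun _ => 1)
  rw [himg] at h
  simp only [mul_one, lintegral_one, Measure.restrict_apply_univ] at h
  rw [h]
  refine lintegral_congr fun x => ?_
  rw [abs_of_nonneg (by positivity)]

/-- Radial-coordinate marginal on a dressing orbit (Proposition 4.3): if `η` is
the Haar probability measure on `SU(2)`, then the pushforward of `η` under
`k ↦ (1/r) log(e^{rΛ}|k₁₁|² + e^{-rΛ}|k₁₂|²)` has density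
`x ↦ r e^{rx}/(e^{rΛ} - e^{-rΛ})` w.r.t. Lebesgue measure on `[-Λ, Λ]`. -/
theorem dressing_orbit_diagonal_marginal
    (r Λ : ℝ) (hr : 0 < r) (hΛ : 0 < Λ)
    (η : Measure (Matrix.specialUnitaryGroup (Fin 2) ℂ)) [IsProbabilityMeasure η]
    (hinv : ∀ g : Matrix.specialUnitaryGroup (Fin 2) ℂ,
      η.map (fun k => g * k) = η) :
    η.map (fun k : Matrix.specialUnitaryGroup (Fin 2) ℂ =>
        (1 / r) * Real.log
          (Real.exp (r * Λ) * Complex.normSq ((k : Matrix (Fin 2) (Fin 2) ℂ) 0 0) +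
           Real.exp (-(r * Λ)) * Complex.normSq ((k : Matrix (Fin 2) (Fin 2) ℂ) 0 1))) =
      ((volume : Measure ℝ).restrict (Set.Icc (-Λ) Λ)).withDensity
        (fun x => ENNReal.ofReal
          (r * Real.exp (r * x) / (Real.exp (r * Λ) - Real.exp (-(r * Λ))))) := by
  have hT : Measurable (fun x : ℝ =>
      (1 / r) * Real.log (Real.exp (r * Λ) * x + Real.exp (-(r * Λ)) * (1 - x))) := by fun_prop
  rw [← map_uniform r Λ hr hΛ _ hT (fun x _ => rfl), ← law_uu η hinv,
    Measure.map_map hT cont_uu.measurable]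
  congr 1
  funext k
  have h := su_row k
  simp only [Function.comp, uu]
  rw [← h]
  ring_nf
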